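/- arXiv:1706.07462 — 4 statements merged into one kernel-verified Lean document; each statement's English description precedes it below -/
import Mathlib

section
/- Let m and m' be monomials of the same degree in R = K[x_1,…,x_n]. Then m ∈ Borel(m') (i.e., m can be obtained from m' by a finite, possibly empty, sequence of Borel moves) if and only if σ_i(m) ≤ σ_i(m') for all i with 1 ≤ i ≤ n. -/
/-!  Monomials in `K[x_1,…,x_n]` are identified with their exponent vectors in `Fin n → ℕ`
(`0`-based indexing: `x_1` corresponds to index `0`).  -/

variable {n : ℕ}

/-- Cumulative exponent vector (`0`-based): `cexp m i = m i + m (i+1) + ⋯ + m (n-1)`,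
so `cexp m i` is the paper's `σ_{i+1}(m)`, and `cexp m n = 0` is the convention
`σ_{n+1}(m) = 0`. -/
def cexp (m : Fin n → ℕ) (i : ℕ) : ℕ :=
  ∑ k : Fin n, if i ≤ (k : ℕ) then m k else 0

/-- `mshift m src tgt` is the exponent vector of `(x_tgt / x_src) · m` (only used when
`src ≠ tgt` and `x_src` divides `m`).  Thus `mshift m j i` is the Borel move `B_{j→i}(m)`
(for `i < j`) and `mshift m i j` is the reverse Borel move `RB_{i→j}(m)` (for `i < j`). -/
def mshift (m : Fin n → ℕ) (src tgt : Fin n) : Fin n → ℕ :=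
  fun k => if k = tgt then m tgt + 1 else if k = src then m src - 1 else m k

/-- `BorelStep a b` : `b` is obtained from `a` by a single Borel move `B_{j→i}`, `i < j`. -/
def BorelStep (a b : Fin n → ℕ) : Prop :=
  ∃ i j : Fin n, i < j ∧ 0 < a j ∧ b = mshift a j i

/-- `InBorel m m'` : `m ∈ Borel(m')`, i.e. `m` is obtained from `m'` by a finite (possibly
empty) sequence of Borel moves. -/
def InBorel (m m' : Fin n → ℕ) : Prop := Relation.ReflTransGen BorelStep m' m

/-- Divisibility of monomials: `m` divides `μ`. -/
def mDvd (m μ : Fin n → ℕ) : Prop := ∀ k, m k ≤ μ k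

/-- `mLexLt m m'` : `m` is lexicographically smaller than `m'` (lex order with
`x_1 > x_2 > ⋯ > x_n`); i.e. `m` comes *later* than `m'` in the lex listing of monomials. -/
def mLexLt (m m' : Fin n → ℕ) : Prop :=
  ∃ i : Fin n, (∀ k, k < i → m k = m' k) ∧ m i < m' i

/-- Total degree of a monomial. -/
def mDeg (m : Fin n → ℕ) : ℕ := ∑ k, m k

lemma cexp_succ_aux (m : Fin n → ℕ) (i : Fin n) :
    cexp m i = m i + cexp m (i + 1) := by
  have h : m i = ∑ k : Fin n, if k = i then m k else 0 := by simp
  unfold cexp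
  conv_rhs => rw [h]
  rw [← Finset.sum_add_distrib]
  apply Finset.sum_congr rfl
  intro k _
  have : k = i ↔ (k : ℕ) = i := Fin.ext_iff
  split_ifs <;> omega

lemma cexp_ge_aux (m : Fin n → ℕ) (i : ℕ) (hi : n ≤ i) : cexp m i = 0 := by
  unfold cexp
  apply Finset.sum_eq_zero
  intro k _
  have := k.2
  rw [if_neg (by omega)]

lemma cexp_shift_aux (m : Fin n → ℕ) (i j : Fin n) (hij : i < j) (hj : 0 < m j) (t : ℕ) :
    cexp (mshift m j i) t + (if t ≤ (j : ℕ) then 1 else 0)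
      = cexp m t + (if t ≤ (i : ℕ) then 1 else 0) := by
  have h1 : ∀ l : Fin n, (if t ≤ (l : ℕ) then 1 else 0)
      = ∑ k : Fin n, if k = l then (if t ≤ (k : ℕ) then 1 else 0) else 0 := by
    intro l; simp
  rw [h1 j, h1 i]
  unfold cexp
  rw [← Finset.sum_add_distrib, ← Finset.sum_add_distrib]
  apply Finset.sum_congr rfl
  intro k _
  unfold mshift
  by_cases hki : k = i
  · subst hki
    have : k ≠ j := ne_of_lt hij
    simp [this]
    split_ifs <;> omega
  · by_cases hkj : k = j
    · subst hkj
      simp [hki]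
      split_ifs <;> omega
    · simp [hki, hkj]

lemma inBorel_aux (m : Fin n → ℕ) : ∀ (N : ℕ) (m' : Fin n → ℕ),
    (∑ i ∈ Finset.range n, cexp m' i) = N → cexp m 0 = cexp m' 0 →
    (∀ i, cexp m i ≤ cexp m' i) → InBorel m m' := by
  intro N
  induction N using Nat.strong_induction_on with
  | _ N ih =>
  intro m' hN h0 hle
  by_cases hall : ∀ i, cexp m i = cexp m' i
  · have : m' = m := by
      funext k
      have a := cexp_succ_aux m k
      have b := cexp_succ_aux m' k
      have c := hall k
      have d := hall (k + 1)
      omega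
    rw [this]
    exact Relation.ReflTransGen.refl
  · have hbd : ∀ i, cexp m i ≠ cexp m' i → i ≤ n := by
      intro i hi
      by_contra hc
      exact hi (by rw [cexp_ge_aux m i (by omega), cexp_ge_aux m' i (by omega)])
    push Not at hall
    obtain ⟨i0, hi0⟩ := hall
    set j := Nat.findGreatest (fun i => cexp m i ≠ cexp m' i) n with hjdef
    have hj : cexp m j ≠ cexp m' j :=
      Nat.findGreatest_spec (P := fun i => cexp m i ≠ cexp m' i) (hbd i0 hi0) hi0
    have hj1 : cexp m (j + 1) = cexp m' (j + 1) := by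
      by_contra hc
      have := Nat.le_findGreatest (P := fun i => cexp m i ≠ cexp m' i) (hbd _ hc) hc
      omega
    have hjn : j < n := by
      by_contra hc
      exact hj (by rw [cexp_ge_aux m j (by omega), cexp_ge_aux m' j (by omega)])
    have hjpos : 0 < j := by
      rcases Nat.eq_zero_or_pos j with h | h
      · rw [h] at hj; exact absurd h0 hj
      · exact h
    clear_value j
    have a := cexp_succ_aux m ⟨j, hjn⟩
    have b := cexp_succ_aux m' ⟨j, hjn⟩
    have hlj := hle j
    simp only at a b
    have hpos : 0 < m' ⟨j, hjn⟩ := by omega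
    have hlt : (⟨j - 1, by omega⟩ : Fin n) < ⟨j, hjn⟩ := by
      rw [Fin.lt_def]; simp only; omega
    have hs := cexp_shift_aux m' ⟨j - 1, by omega⟩ ⟨j, hjn⟩ hlt hpos
    simp only at hs
    set m'' := mshift m' ⟨j, hjn⟩ ⟨j - 1, by omega⟩ with hm''
    have hsj : cexp m'' j + 1 = cexp m' j := by
      have := hs j
      split_ifs at this <;> omega
    have hsne : ∀ t, t ≠ j → cexp m'' t = cexp m' t := by
      intro t ht
      have := hs t
      split_ifs at this <;> omega
    have hstep : BorelStep m' m'' := ⟨_, _, hlt, hpos, hm''⟩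
    refine Relation.ReflTransGen.head hstep (ih _ ?_ m'' rfl ?_ ?_)
    · rw [← hN]
      apply Finset.sum_lt_sum
      · intro t _
        by_cases ht : t = j
        · subst ht; omega
        · exact (hsne t ht).le
      · exact ⟨j, Finset.mem_range.2 hjn, by omega⟩
    · rw [hsne 0 (by omega), h0]
    · intro t
      by_cases ht : t = j
      · subst ht; omega
      · rw [hsne t ht]; exact hle t

/-- For monomials `m`, `m'` of the same degree, `m ∈ Borel(m')` if and only
if `σ_i(m) ≤ σ_i(m')` for all `i`. -/
theorem statement5 (m m' : Fin n → ℕ) (hdeg : mDeg m = mDeg m') :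
    InBorel m m' ↔ ∀ i : ℕ, cexp m i ≤ cexp m' i := by
  constructor
  · intro h t
    unfold InBorel at h
    clear hdeg
    induction h with
    | refl => exact le_rfl
    | tail _ hs ih =>
      obtain ⟨i, j, hij, hj, rfl⟩ := hs
      have := cexp_shift_aux _ i j hij hj t
      rw [Fin.lt_def] at hij
      split_ifs at this <;> omega
  · intro h
    exact inBorel_aux m _ m' rfl (by simpa [cexp, mDeg] using hdeg) h
end

section
/- Let m and m' be monomials of the same degree in R = K[x_1,…,x_n] with m ∈ Borel(m'), and suppose σ_j(m) ≠ σ_j(m') for some index j. Then there exists an index i < j such that x_i divides m and (x_j/x_i)·m ∈ Borel(m'). -/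
/-!  Monomials in `K[x_1,…,x_n]` are identified with their exponent vectors in `Fin n → ℕ`
(`0`-based indexing: `x_1` corresponds to index `0`).  -/

variable {n : ℕ}

lemma cexp_mshift (m : Fin n → ℕ) (s t : Fin n) (hst : s ≠ t) (hs : 0 < m s) (k : ℕ) :
    cexp (mshift m s t) k + (if k ≤ (s : ℕ) then 1 else 0)
      = cexp m k + (if k ≤ (t : ℕ) then 1 else 0) := by
  have h : ∀ u : Fin n, (if k ≤ (u : ℕ) then 1 else 0)
      = ∑ l : Fin n, if l = u then (if k ≤ (u : ℕ) then 1 else 0) else 0 := by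
    intro u; simp
  rw [h s, h t]
  unfold cexp mshift
  rw [← Finset.sum_add_distrib, ← Finset.sum_add_distrib]
  apply Finset.sum_congr rfl
  intro l _
  by_cases h1 : l = t
  · subst h1
    have : l ≠ s := fun h => hst h.symm
    simp [this]; split_ifs <;> omega
  · by_cases h2 : l = s
    · subst h2
      simp [h1]; split_ifs <;> omega
    · simp [h1, h2]

lemma cexp_anti (m : Fin n → ℕ) {a b : ℕ} (h : a ≤ b) : cexp m b ≤ cexp m a := by
  unfold cexp
  apply Finset.sum_le_sum
  intro l _
  split_ifs <;> omega

lemma cexp_const (m : Fin n → ℕ) {a b : ℕ} (h : a ≤ b)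
    (hz : ∀ l : Fin n, a ≤ (l : ℕ) → (l : ℕ) < b → m l = 0) : cexp m a = cexp m b := by
  unfold cexp
  apply Finset.sum_congr rfl
  intro l _
  have := hz l
  split_ifs <;> first | omega | (apply this <;> omega)

lemma cexp_succ (m : Fin n → ℕ) (l : Fin n) : cexp m l = m l + cexp m (l + 1) := by
  have h : m l = ∑ k : Fin n, if k = l then m l else 0 := by simp
  rw [h]
  unfold cexp
  rw [← Finset.sum_add_distrib]
  apply Finset.sum_congr rfl
  intro k _
  by_cases hk : k = l
  · subst hk; simp
  · have : (k : ℕ) ≠ l := fun h => hk (Fin.ext h)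
    simp [hk]; split_ifs <;> omega

lemma cexp_top (m : Fin n → ℕ) {k : ℕ} (hk : n ≤ k) : cexp m k = 0 := by
  unfold cexp
  apply Finset.sum_eq_zero
  intro l _
  have := l.2
  rw [if_neg (by omega)]

lemma eq_of_cexp (m m' : Fin n → ℕ) (h : ∀ j : Fin n, cexp m (j : ℕ) = cexp m' (j : ℕ)) :
    m = m' := by
  funext l
  have h1 := cexp_succ m l
  have h2 := cexp_succ m' l
  have h3 := h l
  have h4 : cexp m (l + 1) = cexp m' (l + 1) := by
    by_cases hl : (l : ℕ) + 1 < n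
    · exact h ⟨l + 1, hl⟩
    · rw [cexp_top m (by omega), cexp_top m' (by omega)]
  omega

/-- Dominance of cumulative exponent vectors, with equal degrees. -/
def Dom (m m' : Fin n → ℕ) : Prop :=
  cexp m 0 = cexp m' 0 ∧ ∀ k, cexp m k ≤ cexp m' k

lemma dom_of_inBorel {m m' : Fin n → ℕ} (h : InBorel m m') : Dom m m' := by
  unfold InBorel at h
  induction h with
  | refl => exact ⟨rfl, fun _ => le_rfl⟩
  | @tail b c _ hs ih =>
    obtain ⟨i, j, hij, hpos, rfl⟩ := hs
    have key := cexp_mshift b j i hij.ne' hpos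
    have hij' : (i : ℕ) < j := hij
    refine ⟨?_, fun k => ?_⟩
    · have := key 0
      simp at this
      rw [this]; exact ih.1
    · have h1 := key k
      have h2 := ih.2 k
      split_ifs at h1 <;> omega

lemma dom_step {m m' : Fin n → ℕ} (h : Dom m m') (j : Fin n)
    (hj : cexp m (j : ℕ) ≠ cexp m' (j : ℕ)) :
    ∃ i : Fin n, i < j ∧ 0 < m i ∧ Dom (mshift m i j) m' := by
  have hlt : cexp m (j : ℕ) < cexp m' (j : ℕ) := lt_of_le_of_ne (h.2 _) hj
  have hex : ((Finset.univ : Finset (Fin n)).filter (fun i => i < j ∧ 0 < m i)).Nonempty := by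
    by_contra hne
    rw [Finset.not_nonempty_iff_eq_empty] at hne
    have hc : cexp m 0 = cexp m j := cexp_const m (Nat.zero_le _) (by
      intro l _ hl
      by_contra h0
      have : l ∈ (Finset.univ : Finset (Fin n)).filter (fun i => i < j ∧ 0 < m i) := by
        simp only [Finset.mem_filter, Finset.mem_univ, true_and]
        exact ⟨hl, Nat.pos_of_ne_zero h0⟩
      rw [hne] at this
      simp at this)
    have h1 := cexp_anti m' (Nat.zero_le (j : ℕ))
    have h2 := h.1
    omega
  obtain ⟨i, hi⟩ := Finset.exists_maximal hex
  have him := hi.1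
  simp only [Finset.mem_filter, Finset.mem_univ, true_and] at him
  have hij : (i : ℕ) < j := him.1
  refine ⟨i, him.1, him.2, ?_⟩
  have key := cexp_mshift m i j him.1.ne him.2
  refine ⟨?_, fun k => ?_⟩
  · have := key 0
    simp at this
    rw [this]; exact h.1
  · have h1 := key k
    have h2 := h.2 k
    by_cases hk : (i : ℕ) < k ∧ k ≤ j
    · have hc : cexp m k = cexp m j := cexp_const m hk.2 (by
        intro l hl1 hl2
        by_contra h0
        have hmem : l ∈ (Finset.univ : Finset (Fin n)).filter (fun i => i < j ∧ 0 < m i) := by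
          simp only [Finset.mem_filter, Finset.mem_univ, true_and]
          exact ⟨hl2, Nat.pos_of_ne_zero h0⟩
        have hil : (i : ℕ) < l := by omega
        have : (l : ℕ) ≤ i := hi.2 hmem (le_of_lt hil)
        omega)
      have h3 := cexp_anti m' hk.2
      split_ifs at h1 <;> omega
    · split_ifs at h1 <;> omega

lemma inBorel_of_dom (N : ℕ) : ∀ {m m' : Fin n → ℕ}, Dom m m' →
    (∑ k : Fin n, (cexp m' (k : ℕ) - cexp m (k : ℕ))) ≤ N → InBorel m m' := by
  induction N with
  | zero =>
    intro m m' h hN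
    have : m = m' := by
      apply eq_of_cexp
      intro j
      have h1 := (Finset.sum_eq_zero_iff.mp (Nat.le_zero.mp hN)) j (Finset.mem_univ _)
      have h2 := h.2 j
      omega
    subst this
    exact Relation.ReflTransGen.refl
  | succ N ih =>
    intro m m' h hN
    by_cases hall : ∀ j : Fin n, cexp m (j : ℕ) = cexp m' (j : ℕ)
    · have := eq_of_cexp m m' hall
      subst this
      exact Relation.ReflTransGen.refl
    · push Not at hall
      obtain ⟨j, hj⟩ := hall
      obtain ⟨i, hij, hpos, hd⟩ := dom_step h j hj
      have hij' : (i : ℕ) < j := hij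
      have key := cexp_mshift m i j hij.ne hpos
      have hb : InBorel (mshift m i j) m' := by
        apply ih hd
        have : (∑ k : Fin n, (cexp m' (k : ℕ) - cexp (mshift m i j) (k : ℕ)))
            < ∑ k : Fin n, (cexp m' (k : ℕ) - cexp m (k : ℕ)) := by
          apply Finset.sum_lt_sum
          · intro k _
            have h1 := key k
            split_ifs at h1 <;> omega
          · refine ⟨j, Finset.mem_univ _, ?_⟩
            have h1 := key j
            have h2 := h.2 j
            split_ifs at h1 <;> omega
        omega
      refine Relation.ReflTransGen.tail hb ⟨i, j, hij, ?_, ?_⟩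
      · simp [mshift]
      · funext k
        have hne : i ≠ j := hij.ne
        unfold mshift
        by_cases h1 : k = i
        · subst h1
          simp [hne]; omega
        · by_cases h2 : k = j
          · subst h2; simp [h1]
          · simp [h1, h2]

/-- If `m`, `m'` have the same degree, `m ∈ Borel(m')`, and
`σ_j(m) ≠ σ_j(m')`, then there is an index `i < j` such that `x_i` divides `m` and
`(x_j/x_i)·m ∈ Borel(m')`. -/
theorem statement6 (m m' : Fin n → ℕ) (hdeg : mDeg m = mDeg m') (hm : InBorel m m')
    (j : Fin n) (hj : cexp m (j : ℕ) ≠ cexp m' (j : ℕ)) :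
    ∃ i : Fin n, i < j ∧ 0 < m i ∧ InBorel (mshift m i j) m' := by
  obtain ⟨i, hij, hpos, hd⟩ := dom_step (dom_of_inBorel hm) j hj
  exact ⟨i, hij, hpos, inBorel_of_dom _ hd le_rfl⟩
end

section
/- Let μ be a monomial (multidegree) in R = K[x_1,…,x_n], let M be a monomial of degree d, suppose some monomial of Borel(M) divides μ, and let M' be the lexicographically latest degree-d monomial of Borel(M) that divides μ. Then every monomial m ∈ Borel(M) that divides μ satisfies m ∈ Borel(M'). -/
/-!  Monomials in `K[x_1,…,x_n]` are identified with their exponent vectors in `Fin n → ℕ`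
(`0`-based indexing: `x_1` corresponds to index `0`).  -/

variable {n : ℕ}

/-- Prefix sums of the exponent vector. -/
def psum (a : Fin n → ℕ) : ℕ → ℕ
  | 0 => 0
  | i + 1 => psum a i + if h : i < n then a ⟨i, h⟩ else 0

lemma psum_succ (a : Fin n → ℕ) (k : Fin n) : psum a (k + 1) = psum a k + a k := by
  simp [psum]

lemma psum_mshift (a : Fin n → ℕ) (i j : Fin n) (hij : i < j) (ha : 0 < a j) (k : ℕ) :
    psum (mshift a j i) k = psum a k + if (i : ℕ) < k ∧ k ≤ (j : ℕ) then 1 else 0 := by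
  have hij' : (i : ℕ) < j := hij
  induction k with
  | zero => simp [psum]
  | succ k ih =>
    by_cases hk : k < n
    · have h1 := psum_succ a ⟨k, hk⟩
      have h2 := psum_succ (mshift a j i) ⟨k, hk⟩
      simp only at h1 h2
      rw [h1, h2, ih]
      have h3 : mshift a j i ⟨k, hk⟩ + (if k = j then 1 else 0)
          = a ⟨k, hk⟩ + (if k = i then 1 else 0) := by
        unfold mshift
        by_cases e1 : k = i
        · have : (⟨k, hk⟩ : Fin n) = i := Fin.ext e1
          have e2 : k ≠ j := by omega
          simp [this, e1, e2]
          omega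
        · have g1 : (⟨k, hk⟩ : Fin n) ≠ i := fun h => e1 (congrArg Fin.val h)
          by_cases e2 : k = j
          · have : (⟨k, hk⟩ : Fin n) = j := Fin.ext e2
            have e3 : ¬ (j : ℕ) = i := by omega
            have e4 : ¬ j = i := fun h => e3 (congrArg Fin.val h)
            simp [this, e2, e3, e4]
            omega
          · have g2 : (⟨k, hk⟩ : Fin n) ≠ j := fun h => e2 (congrArg Fin.val h)
            simp [g1, g2, e1, e2]
      split_ifs at h3 ⊢ <;> omega
    · have := j.2
      simp only [psum, hk, dite_false, ih]
      split_ifs <;> omega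

lemma psum_of_inBorel {m M : Fin n → ℕ} (h : InBorel m M) :
    (∀ k, psum M k ≤ psum m k) ∧ psum M n = psum m n := by
  unfold InBorel at h
  induction h with
  | refl => simp
  | tail _ hs ih =>
    obtain ⟨i, j, hij, ha, rfl⟩ := hs
    refine ⟨fun k => ?_, ?_⟩
    · rw [psum_mshift _ _ _ hij ha]
      exact (ih.1 k).trans (Nat.le_add_right _ _)
    · have := j.2
      rw [psum_mshift _ _ _ hij ha, ih.2, if_neg (by omega), add_zero]

lemma psum_inj {a b : Fin n → ℕ} (h : ∀ k ≤ n, psum a k = psum b k) : a = b := by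
  funext k
  have h1 := psum_succ a k
  have h2 := psum_succ b k
  have h3 := h k (by omega)
  have h4 := h (k + 1) (by omega)
  omega

lemma inBorel_of_psum (b : Fin n → ℕ) (N : ℕ) : ∀ a : Fin n → ℕ,
    (∑ k ∈ Finset.range (n + 1), (psum b k - psum a k) = N) →
    (∀ k ≤ n, psum a k ≤ psum b k) → psum a n = psum b n → InBorel b a := by
  induction N using Nat.strong_induction_on with
  | _ N ih =>
    intro a hN hle hn
    by_cases hall : ∀ k ≤ n, psum a k = psum b k
    · rw [psum_inj hall]
      exact Relation.ReflTransGen.refl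
    push Not at hall
    obtain ⟨k0, hk0, hne⟩ := hall
    have hex : ∃ j, j < n ∧ psum a j < psum b j ∧ psum a (j + 1) = psum b (j + 1) := by
      by_contra hcon
      push Not at hcon
      have : ∀ t, k0 + t ≤ n → psum a (k0 + t) < psum b (k0 + t) := by
        intro t
        induction t with
        | zero => intro _; have := hle k0 hk0; simp only [add_zero]; omega
        | succ t iht =>
          intro ht
          have h1 := hcon (k0 + t) (by omega) (iht (by omega))
          have h2 := hle (k0 + (t + 1)) ht
          rw [← add_assoc] at h2 ⊢
          omega
      have h := this (n - k0) (by omega)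
      rw [Nat.add_sub_cancel' hk0] at h
      omega
    obtain ⟨j, hj, hlt, heq⟩ := hex
    have hj0 : 0 < j := by
      rcases Nat.eq_zero_or_pos j with rfl | h
      · simp [psum] at hlt
      · exact h
    have e1 := psum_succ a ⟨j, hj⟩
    have e2 := psum_succ b ⟨j, hj⟩
    simp only at e1 e2
    have hpos : 0 < a ⟨j, hj⟩ := by omega
    have hij : (⟨j - 1, by omega⟩ : Fin n) < ⟨j, hj⟩ := by
      simp only [Fin.mk_lt_mk]; omega
    have hp := psum_mshift a _ _ hij hpos
    simp only at hp
    refine Relation.ReflTransGen.head (b := mshift a ⟨j, hj⟩ ⟨j - 1, by omega⟩)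
      ⟨_, _, hij, hpos, rfl⟩ ?_
    refine ih _ ?_ _ rfl ?_ ?_
    · rw [← hN]
      apply Finset.sum_lt_sum
      · intro k _
        rw [hp]
        omega
      · refine ⟨j, by simp; omega, ?_⟩
        rw [hp, if_pos (by omega)]
        omega
    · intro k hk
      rw [hp]
      have := hle k hk
      split_ifs with hc
      · have : k = j := by omega
        subst this
        omega
      · omega
    · rw [hp, if_neg (by omega)]
      omega

/-- Let `μ` be a monomial, `M` a monomial of degree `d` such that some
monomial of `Borel(M)` divides `μ`, and let `M'` be the lexicographically latest degree-`d`
monomial of `Borel(M)` dividing `μ` (lex-latest = lex-smallest, since the lex listing goes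
from lex-largest to lex-smallest).  Then every monomial `m ∈ Borel(M)` dividing `μ`
satisfies `m ∈ Borel(M')`. -/
theorem statement7 (μ M M' : Fin n → ℕ) (d : ℕ) (hMd : mDeg M = d)
    (hM'B : InBorel M' M) (hM'dvd : mDvd M' μ)
    (hlatest : ∀ m, InBorel m M → mDvd m μ → m ≠ M' → mLexLt M' m) :
    ∀ m, InBorel m M → mDvd m μ → InBorel m M' := by
  intro m hm hmd
  obtain ⟨h1, h1n⟩ := psum_of_inBorel hm
  obtain ⟨h2, h2n⟩ := psum_of_inBorel hM'B
  let w : Fin n → ℕ := fun k =>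
    min (psum m (k + 1)) (psum M' (k + 1)) - min (psum m k) (psum M' k)
  have hw : ∀ k ≤ n, psum w k = min (psum m k) (psum M' k) := by
    intro k
    induction k with
    | zero => intro _; simp [psum]
    | succ k ih =>
      intro hk
      have e1 := psum_succ w ⟨k, hk⟩
      have e2 := psum_succ m ⟨k, hk⟩
      have e3 := psum_succ M' ⟨k, hk⟩
      have e4 := ih (by omega)
      have e5 : w ⟨k, hk⟩ = min (psum m (k + 1)) (psum M' (k + 1)) -
        min (psum m k) (psum M' k) := rfl
      simp only at e1 e2 e3
      omega
  have hwB : InBorel w M := by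
    refine inBorel_of_psum w _ M rfl ?_ ?_
    · intro k hk
      rw [hw k hk]
      exact le_min (h1 k) (h2 k)
    · rw [hw n le_rfl, ← h1n, ← h2n, min_self]
  have hwd : mDvd w μ := by
    intro k
    have e2 := psum_succ m k
    have e3 := psum_succ M' k
    have e4 := hmd k
    have e5 := hM'dvd k
    have e6 : w k = min (psum m (k + 1)) (psum M' (k + 1)) -
        min (psum m k) (psum M' k) := rfl
    omega
  have hwM : w = M' := by
    by_contra hne
    obtain ⟨i, hi, hlt⟩ := hlatest w hwB hwd hne
    have hpre : ∀ k, k ≤ (i : ℕ) → psum M' k = psum w k := by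
      intro k
      induction k with
      | zero => intro _; rfl
      | succ k ih =>
        intro hk
        have hkn : k < n := by omega
        have e1 := psum_succ w ⟨k, hkn⟩
        have e2 := psum_succ M' ⟨k, hkn⟩
        have e3 := hi ⟨k, hkn⟩ (by rw [Fin.lt_def]; exact hk)
        have e4 := ih (by omega)
        simp only at e1 e2
        omega
    have e0 := hpre i le_rfl
    have e1 := psum_succ w i
    have e2 := psum_succ M' i
    have e3 := hw (i + 1) (by omega)
    omega
  refine inBorel_of_psum m _ M' rfl ?_ ?_
  · intro k hk
    have := hw k hk
    rw [hwM] at this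
    omega
  · rw [← h1n, ← h2n]
end

section
/- Let μ, m, and M' be monomials in R = K[x_1,…,x_n] such that m divides μ and M' divides μ, and let j be the largest index with σ_j(m) > σ_j(M'). Then for any i < j with x_i dividing M', the monomial (x_j/x_i)·M' divides μ. -/
/-!  Monomials in `K[x_1,…,x_n]` are identified with their exponent vectors in `Fin n → ℕ`
(`0`-based indexing: `x_1` corresponds to index `0`).  -/

variable {n : ℕ}

/-- Let `μ`, `m`, `M'` be monomials with `m ∣ μ` and `M' ∣ μ`, and let `j`
be the largest index with `σ_j(m) > σ_j(M')`.  Then for any `i < j` with `x_i` dividing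
`M'`, the monomial `(x_j/x_i)·M'` divides `μ`. -/
theorem statement9 (μ m M' : Fin n → ℕ) (hm : mDvd m μ) (hM' : mDvd M' μ)
    (j : Fin n) (hj : cexp M' (j : ℕ) < cexp m (j : ℕ))
    (hjmax : ∀ k : Fin n, j < k → ¬ cexp M' (k : ℕ) < cexp m (k : ℕ))
    (i : Fin n) (hij : i < j) (hi : 0 < M' i) :
    mDvd (mshift M' i j) μ := by
  have succ : ∀ a : Fin n → ℕ, cexp a (j : ℕ) = a j + cexp a ((j : ℕ) + 1) := by
    intro a
    unfold cexp
    have h : a j = ∑ k : Fin n, if k = j then a k else 0 := by simp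
    rw [h, ← Finset.sum_add_distrib]
    refine Finset.sum_congr rfl fun k _ => ?_
    by_cases hk : k = j
    · subst hk; simp
    · have hk' : (k : ℕ) ≠ (j : ℕ) := fun h => hk (Fin.ext h)
      have : ((j : ℕ) ≤ (k : ℕ)) ↔ ((j : ℕ) + 1 ≤ (k : ℕ)) := by omega
      simp only [this, hk, if_false, zero_add]
  have hle : cexp m ((j : ℕ) + 1) ≤ cexp M' ((j : ℕ) + 1) := by
    by_cases h : (j : ℕ) + 1 < n
    · exact not_lt.mp (hjmax ⟨(j : ℕ) + 1, h⟩ (Fin.lt_def.mpr (Nat.lt_succ_self _)))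
    · have hz : cexp m ((j : ℕ) + 1) = 0 := by
        unfold cexp
        refine Finset.sum_eq_zero fun k _ => if_neg ?_
        have := k.isLt
        omega
      omega
  have h1 := succ m
  have h2 := succ M'
  intro k
  have hmj := hm j
  have hk := hM' k
  unfold mshift
  split_ifs with h3 h4
  · subst h3; omega
  · subst h4; omega
  · exact hk
end
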